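/- Let T be a tree with γ_t^{oi}(S(T)) = (4n(T) − l(T) + s(T) − 2)/3 that has no strong leaves, and let v_1 v_2 ⋯ v_{d+1} be a diametral path in T (a path of length equal to the diameter d of T) with d ≥ 3. Then v_3 has degree 2 in T. -/

import Mathlib

open SimpleGraph

universe u

/-- A total outer-independent dominating set: every vertex has a neighbor in `D`,
and the complement of `D` is an independent set. -/
def IsTOIDS {V : Type u} (G : SimpleGraph V) (D : Set V) : Prop :=
  (∀ v : V, ∃ u ∈ D, G.Adj v u) ∧ ∀ u ∉ D, ∀ w ∉ D, ¬ G.Adj u w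

/-- The total outer-independent domination number. -/
noncomputable def toidNumber {V : Type u} (G : SimpleGraph V) : ℕ :=
  sInf {n : ℕ | ∃ D : Set V, IsTOIDS G D ∧ D.ncard = n}

/-- The subdivision graph: each edge is replaced by a new vertex adjacent exactly to
its two endpoints. -/
def subdivision {V : Type u} (G : SimpleGraph V) : SimpleGraph (V ⊕ G.edgeSet) :=
  SimpleGraph.fromRel fun x y =>
    ∃ (v : V) (e : G.edgeSet), x = Sum.inl v ∧ y = Sum.inr e ∧ v ∈ (e : Sym2 V)

/-- A leaf: a vertex with exactly one neighbor. -/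
def IsLeafVert {V : Type u} (G : SimpleGraph V) (v : V) : Prop := ∃! u, G.Adj v u

/-- A support vertex: a vertex adjacent to a leaf. -/
def IsSupportVert {V : Type u} (G : SimpleGraph V) (v : V) : Prop :=
  ∃ u, G.Adj v u ∧ IsLeafVert G u

/-- A strong support vertex: a vertex adjacent to at least two leaves. -/
def IsStrongSupportVert {V : Type u} (G : SimpleGraph V) (v : V) : Prop :=
  ∃ u w, u ≠ w ∧ G.Adj v u ∧ G.Adj v w ∧ IsLeafVert G u ∧ IsLeafVert G w

/-- A strong leaf: a leaf adjacent to a strong support vertex. -/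
def IsStrongLeaf {V : Type u} (G : SimpleGraph V) (v : V) : Prop :=
  IsLeafVert G v ∧ ∃ u, G.Adj v u ∧ IsStrongSupportVert G u

/-- A weak leaf: a leaf that is not a strong leaf. -/
def IsWeakLeaf {V : Type u} (G : SimpleGraph V) (v : V) : Prop :=
  IsLeafVert G v ∧ ¬ IsStrongLeaf G v

/-- A semi-support vertex: neither a leaf nor a support vertex, but adjacent to a
support vertex. -/
def IsSemiSupportVert {V : Type u} (G : SimpleGraph V) (v : V) : Prop :=
  ¬ IsLeafVert G v ∧ ¬ IsSupportVert G v ∧ ∃ u, G.Adj v u ∧ IsSupportVert G u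

/-- The number of leaves, with the convention that `P₂` has exactly one leaf. -/
noncomputable def leafCount {V : Type u} (G : SimpleGraph V) : ℕ :=
  if Nat.card V = 2 then 1 else {v | IsLeafVert G v}.ncard

/-- The number of support vertices, with the convention that `P₂` has exactly one
support vertex. -/
noncomputable def supportCount {V : Type u} (G : SimpleGraph V) : ℕ :=
  if Nat.card V = 2 then 1 else {v | IsSupportVert G v}.ncard

/-- The graph obtained from `G` by attaching a path `P_r` to the vertex `v`:
the new vertices form a path `p₀ p₁ ⋯ p_{r-1}` and `v` is joined to the end `p₀`. -/
def attachPath {V : Type u} (G : SimpleGraph V) (v : V) (r : ℕ) :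
    SimpleGraph (V ⊕ Fin r) :=
  SimpleGraph.fromRel fun x y =>
    (∃ a b, x = Sum.inl a ∧ y = Sum.inl b ∧ G.Adj a b) ∨
    (∃ i j : Fin r, x = Sum.inr i ∧ y = Sum.inr j ∧ (j : ℕ) = (i : ℕ) + 1) ∨
    (∃ i : Fin r, x = Sum.inl v ∧ y = Sum.inr i ∧ (i : ℕ) = 0)

/-- The graph obtained from `G` by adding a disjoint copy of the tree `Q_r`
(`r` paths `P₃` joined to a central vertex) and identifying the central vertex
of `Q_r` with the vertex `v` of `G`. -/
def attachQ {V : Type u} (G : SimpleGraph V) (v : V) (r : ℕ) :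
    SimpleGraph (V ⊕ Fin r × Fin 3) :=
  SimpleGraph.fromRel fun x y =>
    (∃ a b, x = Sum.inl a ∧ y = Sum.inl b ∧ G.Adj a b) ∨
    (∃ i : Fin r, x = Sum.inl v ∧ y = Sum.inr (i, 0)) ∨
    (∃ (i : Fin r) (j k : Fin 3),
      x = Sum.inr (i, j) ∧ y = Sum.inr (i, k) ∧ (k : ℕ) = (j : ℕ) + 1)

/-- The family `F`: all trees obtainable from `P₂` by repeatedly
(F1) attaching `P₁` to a support vertex, (F2) attaching `P₂` to a support or
semi-support vertex, (F3) attaching `P₃` to a weak leaf. -/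
inductive InFamilyF : {W : Type u} → SimpleGraph W → Prop
  | base {W : Type u} (G : SimpleGraph W) (e : G ≃g SimpleGraph.pathGraph 2) :
      InFamilyF G
  | op1 {W : Type u} {G' : SimpleGraph W} {v : W} (hv : IsSupportVert G' v)
      (hF : InFamilyF G') {U : Type u} (G : SimpleGraph U)
      (e : G ≃g attachPath G' v 1) : InFamilyF G
  | op2 {W : Type u} {G' : SimpleGraph W} {v : W}
      (hv : IsSupportVert G' v ∨ IsSemiSupportVert G' v)
      (hF : InFamilyF G') {U : Type u} (G : SimpleGraph U)
      (e : G ≃g attachPath G' v 2) : InFamilyF G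
  | op3 {W : Type u} {G' : SimpleGraph W} {v : W} (hv : IsWeakLeaf G' v)
      (hF : InFamilyF G') {U : Type u} (G : SimpleGraph U)
      (e : G ≃g attachPath G' v 3) : InFamilyF G

/-- The family `𝒯`: all trees obtainable from `P₂` by repeatedly
(O1) attaching `P₁` to a support vertex, (O2) attaching `P₃` to a support vertex or a
weak leaf, (O3) adding a copy of `Q_r` (`r ≥ 2`) identifying its central vertex with a
weak leaf. -/
inductive InFamilyT : {W : Type u} → SimpleGraph W → Prop
  | base {W : Type u} (G : SimpleGraph W) (e : G ≃g SimpleGraph.pathGraph 2) :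
      InFamilyT G
  | op1 {W : Type u} {G' : SimpleGraph W} {v : W} (hv : IsSupportVert G' v)
      (hF : InFamilyT G') {U : Type u} (G : SimpleGraph U)
      (e : G ≃g attachPath G' v 1) : InFamilyT G
  | op2 {W : Type u} {G' : SimpleGraph W} {v : W}
      (hv : IsSupportVert G' v ∨ IsWeakLeaf G' v)
      (hF : InFamilyT G') {U : Type u} (G : SimpleGraph U)
      (e : G ≃g attachPath G' v 3) : InFamilyT G
  | op3 {W : Type u} {G' : SimpleGraph W} {v : W} (hv : IsWeakLeaf G' v)
      (hF : InFamilyT G') {r : ℕ} (hr : 2 ≤ r) {U : Type u} (G : SimpleGraph U)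
      (e : G ≃g attachQ G' v r) : InFamilyT G
theorem subdivision_adj_inl_inr {V : Type u} {G : SimpleGraph V} {v : V} {e : G.edgeSet} :
    (subdivision G).Adj (Sum.inl v) (Sum.inr e) ↔ v ∈ (e : Sym2 V) := by
  simp [subdivision]

theorem subdivision_adj_inr_inl {V : Type u} {G : SimpleGraph V} {v : V} {e : G.edgeSet} :
    (subdivision G).Adj (Sum.inr e) (Sum.inl v) ↔ v ∈ (e : Sym2 V) := by
  rw [adj_comm, subdivision_adj_inl_inr]

theorem not_subdivision_adj_inl_inl {V : Type u} {G : SimpleGraph V} {v w : V} :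
    ¬ (subdivision G).Adj (Sum.inl v) (Sum.inl w) := by
  simp [subdivision]

theorem not_subdivision_adj_inr_inr {V : Type u} {G : SimpleGraph V} {e f : G.edgeSet} :
    ¬ (subdivision G).Adj (Sum.inr e) (Sum.inr f) := by
  simp [subdivision]

/-- A criterion for the complement of a vertex set of a subdivision graph to be a TOIDS. -/
theorem isTOIDS_subdivision_compl {V : Type u} {G : SimpleGraph V} {O : Set (V ⊕ G.edgeSet)}
    (hv : ∀ v : V, ∃ e : G.edgeSet, v ∈ (e : Sym2 V) ∧ Sum.inr e ∉ O)
    (he : ∀ e : G.edgeSet, ∃ v ∈ (e : Sym2 V), Sum.inl v ∉ O)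
    (hO : ∀ (v : V) (e : G.edgeSet), v ∈ (e : Sym2 V) → Sum.inl v ∈ O → Sum.inr e ∉ O) :
    IsTOIDS (subdivision G) Oᶜ := by
  refine ⟨?_, ?_⟩
  · rintro (v | e)
    · obtain ⟨e, hve, heO⟩ := hv v
      exact ⟨_, heO, subdivision_adj_inl_inr.2 hve⟩
    · obtain ⟨v, hve, hvO⟩ := he e
      exact ⟨_, hvO, subdivision_adj_inr_inl.2 hve⟩
  · rintro (v | e) hx (w | f) hy hadj
    · exact not_subdivision_adj_inl_inl hadj
    · exact hO v f (subdivision_adj_inl_inr.1 hadj) (not_not.1 hx) (not_not.1 hy)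
    · exact hO w e (subdivision_adj_inr_inl.1 hadj) (not_not.1 hy) (not_not.1 hx)
    · exact not_subdivision_adj_inr_inr hadj

theorem toidNumber_add_ncard_le {W : Type u} [Finite W] {G : SimpleGraph W} {O : Set W}
    (hO : IsTOIDS G Oᶜ) : toidNumber G + O.ncard ≤ Nat.card W := by
  have h : toidNumber G ≤ Oᶜ.ncard := Nat.sInf_le ⟨Oᶜ, hO, rfl⟩
  have := Set.ncard_add_ncard_compl O
  omega

/-- The third colour at an edge whose ends have different colours in `ZMod 3`. -/
def edgeColor {V : Type u} (h : V → ZMod 3) : Sym2 V → ZMod 3 :=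
  Sym2.lift ⟨fun a b => -(h a + h b), fun _ _ => congrArg Neg.neg (add_comm _ _)⟩

@[simp]
theorem edgeColor_mk {V : Type u} (h : V → ZMod 3) (a b : V) :
    edgeColor h s(a, b) = -(h a + h b) := rfl

theorem edgeColor_ne {V : Type u} {G : SimpleGraph V} {h : V → ZMod 3}
    (hp : ∀ u v, G.Adj u v → h u ≠ h v) {e : Sym2 V} (he : e ∈ G.edgeSet) {v : V} (hv : v ∈ e) :
    edgeColor h e ≠ h v := by
  obtain ⟨w, rfl⟩ := Sym2.mem_iff_exists.1 hv
  have := hp v w he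
  rw [edgeColor_mk]
  revert this
  generalize h v = a
  generalize h w = b
  revert a b
  decide

/-- The colouring of the subdivision graph induced by a colouring of the graph. -/
def subdivColor {V : Type u} (G : SimpleGraph V) (h : V → ZMod 3) : V ⊕ G.edgeSet → ZMod 3 :=
  Sum.elim h fun e => edgeColor h e

open Classical in
/-- Replace each subdivision vertex next to a leaf by such a leaf. -/
noncomputable def pushToLeaf {V : Type u} (G : SimpleGraph V) : V ⊕ G.edgeSet → V ⊕ G.edgeSet :=
  Sum.elim Sum.inl fun e =>
    if he : ∃ v ∈ (e : Sym2 V), IsLeafVert G v then Sum.inl he.choose else Sum.inr e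

/-- A colour class of the subdivision graph, pushed to the leaves. -/
def pushedClass {V : Type u} (G : SimpleGraph V) (h : V → ZMod 3) (c : ZMod 3) :
    Set (V ⊕ G.edgeSet) :=
  pushToLeaf G '' {x | subdivColor G h x = c}

theorem IsLeafVert.edge_eq {V : Type u} {G : SimpleGraph V} {v : V} (hv : IsLeafVert G v)
    {e f : Sym2 V} (he : e ∈ G.edgeSet) (hf : f ∈ G.edgeSet) (hve : v ∈ e) (hvf : v ∈ f) :
    e = f := by
  obtain ⟨a, rfl⟩ := Sym2.mem_iff_exists.1 hve
  obtain ⟨b, rfl⟩ := Sym2.mem_iff_exists.1 hvf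
  exact Sym2.congr_right.2 (hv.unique he hf)

theorem inr_mem_pushedClass {V : Type u} {G : SimpleGraph V} {h : V → ZMod 3} {c : ZMod 3}
    {e : G.edgeSet} (he : Sum.inr e ∈ pushedClass G h c) :
    edgeColor h e = c ∧ ∀ v ∈ (e : Sym2 V), ¬ IsLeafVert G v := by
  obtain ⟨x | f, hx, hxe⟩ := he
  · simp [pushToLeaf] at hxe
  · by_cases hf : ∃ v ∈ (f : Sym2 V), IsLeafVert G v
    · simp [pushToLeaf, hf] at hxe
    · simp only [pushToLeaf, Sum.elim_inr, hf, dite_false, Sum.inr.injEq] at hxe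
      subst hxe
      exact ⟨hx, fun v hv hl => hf ⟨v, hv, hl⟩⟩

theorem inl_mem_pushedClass {V : Type u} {G : SimpleGraph V} {h : V → ZMod 3} {c : ZMod 3}
    {v : V} (hv : Sum.inl v ∈ pushedClass G h c) :
    h v = c ∨ IsLeafVert G v ∧ ∃ e : G.edgeSet, v ∈ (e : Sym2 V) ∧ edgeColor h e = c ∧
      pushToLeaf G (Sum.inr e) = Sum.inl v := by
  obtain ⟨x | f, hx, hxv⟩ := hv
  · simp only [pushToLeaf, Sum.elim_inl, Sum.inl.injEq] at hxv
    exact Or.inl (hxv ▸ hx)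
  · by_cases hf : ∃ v ∈ (f : Sym2 V), IsLeafVert G v
    · have h' := hxv
      simp only [pushToLeaf, Sum.elim_inr, hf, dite_true, Sum.inl.injEq] at hxv
      exact Or.inr ⟨hxv ▸ hf.choose_spec.2, f, hxv ▸ hf.choose_spec.1, hx, h'⟩
    · simp [pushToLeaf, hf] at hxv

theorem inl_mem_pushedClass_of_color {V : Type u} {G : SimpleGraph V} {h : V → ZMod 3}
    {c : ZMod 3} {v : V} (hv : h v = c) : Sum.inl v ∈ pushedClass G h c :=
  ⟨Sum.inl v, hv, rfl⟩

theorem ncard_pushedClass {V : Type u} {G : SimpleGraph V} {h : V → ZMod 3}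
    (hp : ∀ u v, G.Adj u v → h u ≠ h v) (c : ZMod 3) :
    (pushedClass G h c).ncard = {x | subdivColor G h x = c}.ncard := by
  refine Set.InjOn.ncard_image ?_
  have key : ∀ (v : V) (e : G.edgeSet), h v = c → edgeColor h e = c →
      Sum.inl v ≠ pushToLeaf G (Sum.inr e) := by
    intro v e hv hec heq
    by_cases he : ∃ v ∈ (e : Sym2 V), IsLeafVert G v
    · simp only [pushToLeaf, Sum.elim_inr, he, dite_true, Sum.inl.injEq] at heq
      exact edgeColor_ne hp e.2 (heq ▸ he.choose_spec.1 : v ∈ (e : Sym2 V)) (hec.trans hv.symm)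
    · simp [pushToLeaf, he] at heq
  rintro (v | e) hx (w | f) hy hxy
  · exact hxy
  · exact (key v f hx hy hxy).elim
  · exact (key w e hy hx hxy.symm).elim
  · by_cases he : ∃ v ∈ (e : Sym2 V), IsLeafVert G v <;>
      by_cases hf : ∃ v ∈ (f : Sym2 V), IsLeafVert G v <;>
      simp only [pushToLeaf, Sum.elim_inr, he, hf, dite_true, dite_false, Sum.inl.injEq,
        reduceCtorEq] at hxy
    · have h1 := he.choose_spec
      rw [hxy] at h1
      exact congrArg Sum.inr (Subtype.ext (h1.2.edge_eq e.2 f.2 h1.1 hf.choose_spec.1))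
    · exact hxy

theorem sum_ncard_pushedClass {V : Type u} [Finite V] {G : SimpleGraph V} {h : V → ZMod 3}
    (hp : ∀ u v, G.Adj u v → h u ≠ h v) :
    ∑ c, (pushedClass G h c).ncard = Nat.card (V ⊕ G.edgeSet) := by
  classical
  have := Fintype.ofFinite (V ⊕ G.edgeSet)
  rw [Nat.card_eq_fintype_card, ← Finset.card_univ,
    Finset.card_eq_sum_card_fiberwise (f := subdivColor G h) (t := Finset.univ) (by simp)]
  refine Finset.sum_congr rfl fun c _ => ?_
  rw [ncard_pushedClass hp, ← Set.ncard_coe_finset]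
  simp

/-- A proper colouring in which each non-leaf sees every other colour. -/
def IsRainbowColoring {V : Type u} (G : SimpleGraph V) (h : V → ZMod 3) : Prop :=
  (∀ u v, G.Adj u v → h u ≠ h v) ∧
    ∀ v, ¬ IsLeafVert G v → ∀ c, c ≠ h v → ∃ u, G.Adj v u ∧ h u = c

section Domination

variable {V : Type u} {G : SimpleGraph V} {h : V → ZMod 3}

theorem exists_edge_notMem_pushedClass (hnbr : ∀ v, ∃ u, G.Adj v u)
    (hh : IsRainbowColoring G h) (c : ZMod 3) (v : V) :
    ∃ e : G.edgeSet, v ∈ (e : Sym2 V) ∧ Sum.inr e ∉ pushedClass G h c := by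
  by_cases hl : IsLeafVert G v
  · obtain ⟨u, hu⟩ := hnbr v
    exact ⟨⟨s(v, u), hu⟩, by simp, fun he => (inr_mem_pushedClass he).2 v (by simp) hl⟩
  · by_cases hc : h v = c
    · obtain ⟨u, hu⟩ := hnbr v
      exact ⟨⟨s(v, u), hu⟩, by simp, fun he => edgeColor_ne hh.1 hu (Sym2.mem_mk_left v u)
        ((inr_mem_pushedClass he).1.trans hc.symm)⟩
    · obtain ⟨u, hu, huc⟩ := hh.2 v hl c (Ne.symm hc)
      exact ⟨⟨s(v, u), hu⟩, by simp, fun he => edgeColor_ne hh.1 hu (Sym2.mem_mk_right v u)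
        ((inr_mem_pushedClass he).1.trans huc.symm)⟩

theorem exists_end_notMem_pushedClass (hp : ∀ u v, G.Adj u v → h u ≠ h v) (c : ZMod 3)
    (e : G.edgeSet) : ∃ v ∈ (e : Sym2 V), Sum.inl v ∉ pushedClass G h c := by
  obtain ⟨e, he⟩ := e
  induction e with | _ u v
  by_contra! hc
  have hu := inl_mem_pushedClass (hc u (by simp))
  have hv := inl_mem_pushedClass (hc v (by simp))
  have key : ∀ (x : V) (f : G.edgeSet), x ∈ s(u, v) → x ∈ (f : Sym2 V) → IsLeafVert G x →
      f = ⟨s(u, v), he⟩ := fun x f hx hf hl => Subtype.ext (hl.edge_eq f.2 he hf hx)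
  rcases hu with hu | ⟨hul, f, huf, hfc, hfu⟩ <;> rcases hv with hv | ⟨hvl, g, hvg, hgc, hgv⟩
  · exact hp u v he (hu.trans hv.symm)
  · obtain rfl := key v g (by simp) hvg hvl
    exact edgeColor_ne hp he (Sym2.mem_mk_left u v) (hgc.trans hu.symm)
  · obtain rfl := key u f (by simp) huf hul
    exact edgeColor_ne hp he (Sym2.mem_mk_right u v) (hfc.trans hv.symm)
  · obtain rfl := key u f (by simp) huf hul
    obtain rfl := key v g (by simp) hvg hvl
    exact G.ne_of_adj he (Sum.inl_injective (hfu.symm.trans hgv))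

theorem inr_notMem_pushedClass_of_inl_mem (hp : ∀ u v, G.Adj u v → h u ≠ h v) {c : ZMod 3}
    {v : V} {e : G.edgeSet} (hve : v ∈ (e : Sym2 V)) (hv : Sum.inl v ∈ pushedClass G h c) :
    Sum.inr e ∉ pushedClass G h c := by
  intro he
  obtain ⟨hec, hel⟩ := inr_mem_pushedClass he
  rcases inl_mem_pushedClass hv with hv | ⟨hl, -⟩
  · exact edgeColor_ne hp e.2 hve (hec.trans hv.symm)
  · exact hel v hve hl

theorem isTOIDS_pushedClass_compl (hnbr : ∀ v, ∃ u, G.Adj v u)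
    (hh : IsRainbowColoring G h) (c : ZMod 3) :
    IsTOIDS (subdivision G) (pushedClass G h c)ᶜ :=
  isTOIDS_subdivision_compl (exists_edge_notMem_pushedClass hnbr hh c)
    (exists_end_notMem_pushedClass hh.1 c)
    fun _ _ hve hv => inr_notMem_pushedClass_of_inl_mem hh.1 hve hv

theorem inr_notMem_pushedClass_of_color (hp : ∀ u v, G.Adj u v → h u ≠ h v) {v : V}
    {e : G.edgeSet} (hve : v ∈ (e : Sym2 V)) : Sum.inr e ∉ pushedClass G h (h v) :=
  fun he => edgeColor_ne hp e.2 hve (inr_mem_pushedClass he).1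

open Classical in
/-- The neighbour `u` of `x` if it is a leaf, and otherwise the subdivision vertex of `xu`. -/
noncomputable def leafOrEdge (G : SimpleGraph V) (x : V) (u : G.neighborSet x) : V ⊕ G.edgeSet :=
  if IsLeafVert G u then Sum.inl (u : V) else Sum.inr ⟨s(x, u), u.2⟩

theorem leafOrEdge_eq_inl {x v : V} {u : G.neighborSet x} (hu : leafOrEdge G x u = Sum.inl v) :
    (u : V) = v ∧ IsLeafVert G v := by
  unfold leafOrEdge at hu
  split_ifs at hu with hl
  have := Sum.inl_injective hu
  exact ⟨this, this ▸ hl⟩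

theorem leafOrEdge_eq_inr {x : V} {e : G.edgeSet} {u : G.neighborSet x}
    (hu : leafOrEdge G x u = Sum.inr e) : (e : Sym2 V) = s(x, (u : V)) ∧ ¬ IsLeafVert G u := by
  unfold leafOrEdge at hu
  split_ifs at hu with hl
  exact ⟨(congrArg Subtype.val (Sum.inr_injective hu)).symm, hl⟩

theorem leafOrEdge_injective (G : SimpleGraph V) (x : V) :
    Function.Injective (leafOrEdge G x) := by
  intro u u' heq
  rcases hu : leafOrEdge G x u with v | e
  · have h1 := (leafOrEdge_eq_inl hu).1
    have h2 := (leafOrEdge_eq_inl (heq ▸ hu)).1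
    exact Subtype.ext (h1.trans h2.symm)
  · have h1 := (leafOrEdge_eq_inr hu).1
    have h2 := (leafOrEdge_eq_inr (heq ▸ hu)).1
    exact Subtype.ext (Sym2.congr_right.1 (h1.symm.trans h2))

theorem leafOrEdge_notMem_pushedClass (hp : ∀ u v, G.Adj u v → h u ≠ h v) {x : V}
    (u : G.neighborSet x) : leafOrEdge G x u ∉ pushedClass G h (h x) := by
  rcases hu : leafOrEdge G x u with v | e
  · obtain ⟨rfl, hl⟩ := leafOrEdge_eq_inl hu
    intro hm
    rcases inl_mem_pushedClass hm with hm | ⟨-, e, hue, hec, -⟩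
    · exact hp x u u.2 hm.symm
    · have he : (e : Sym2 V) = s(x, (u : V)) := hl.edge_eq e.2 u.2 hue (by simp)
      exact edgeColor_ne hp e.2 (he ▸ Sym2.mem_mk_left x _) hec
  · refine inr_notMem_pushedClass_of_color hp ?_
    rw [(leafOrEdge_eq_inr hu).1]
    simp

/-- Exchanging `x` for the pendant structure at several of its neighbours. -/
def exchangedClass (G : SimpleGraph V) (h : V → ZMod 3) (x : V) (S : Set (G.neighborSet x)) :
    Set (V ⊕ G.edgeSet) :=
  (pushedClass G h (h x) \ {Sum.inl x}) ∪ leafOrEdge G x '' S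

theorem ncard_exchangedClass [Finite V] (hp : ∀ u v, G.Adj u v → h u ≠ h v) (x : V)
    (S : Set (G.neighborSet x)) :
    (exchangedClass G h x S).ncard + 1 = (pushedClass G h (h x)).ncard + S.ncard := by
  have hx : Sum.inl x ∈ pushedClass G h (h x) := inl_mem_pushedClass_of_color rfl
  have hdisj : Disjoint (pushedClass G h (h x) \ {Sum.inl x}) (leafOrEdge G x '' S) := by
    rw [Set.disjoint_right]
    rintro _ ⟨u, -, rfl⟩ hu
    exact leafOrEdge_notMem_pushedClass hp u hu.1
  rw [exchangedClass, Set.ncard_union_eq hdisj,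
    Set.ncard_image_of_injective _ (leafOrEdge_injective G x)]
  have := Set.ncard_sdiff_singleton_add_one hx
  omega

theorem isTOIDS_exchangedClass_compl (hnbr : ∀ v, ∃ u, G.Adj v u)
    (hh : IsRainbowColoring G h) {x p : V} (hxp : G.Adj x p) {S : Set (G.neighborSet x)}
    (hpS : ∀ u ∈ S, (u : V) ≠ p)
    (hS : ∀ u ∈ S, IsLeafVert G u ∨ IsSupportVert G u) :
    IsTOIDS (subdivision G) (exchangedClass G h x S)ᶜ := by
  have hp := hh.1
  refine isTOIDS_subdivision_compl ?_ ?_ ?_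
  · intro v
    by_cases hvx : v = x
    · subst hvx
      refine ⟨⟨s(v, p), hxp⟩, by simp, ?_⟩
      rintro (⟨he, -⟩ | ⟨u, huS, hu⟩)
      · exact inr_notMem_pushedClass_of_color hp (by simp) he
      · exact hpS u huS (Sym2.congr_right.1 (leafOrEdge_eq_inr hu).1).symm
    by_cases hvS : ∃ u ∈ S, (u : V) = v
    · obtain ⟨y, hyS, rfl⟩ := hvS
      by_cases hl : IsLeafVert G (y : V)
      · refine ⟨⟨s(x, (y : V)), y.2⟩, by simp, ?_⟩
        rintro (⟨he, -⟩ | ⟨u, huS, hu⟩)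
        · exact inr_notMem_pushedClass_of_color hp (by simp) he
        · obtain ⟨hu1, hu2⟩ := leafOrEdge_eq_inr hu
          rw [← Sym2.congr_right.1 hu1] at hu2
          exact hu2 hl
      · obtain ⟨z, hyz, hz⟩ := (hS y hyS).resolve_left hl
        refine ⟨⟨s((y : V), z), hyz⟩, by simp, ?_⟩
        rintro (⟨he, -⟩ | ⟨u, huS, hu⟩)
        · exact (inr_mem_pushedClass he).2 z (by simp) hz
        · rcases Sym2.eq_iff.1 (leafOrEdge_eq_inr hu).1 with ⟨h1, -⟩ | ⟨-, h1⟩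
          · exact hvx h1
          · subst h1
            exact hpS y hyS (hz.unique y.2 hxp)
    · obtain ⟨e, hve, he⟩ := exists_edge_notMem_pushedClass hnbr hh (h x) v
      refine ⟨e, hve, ?_⟩
      rintro (⟨he', -⟩ | ⟨u, huS, hu⟩)
      · exact he he'
      · rw [(leafOrEdge_eq_inr hu).1, Sym2.mem_iff] at hve
        rcases hve with hve | hve
        · exact hvx hve
        · exact hvS ⟨u, huS, hve.symm⟩
  · intro e
    by_cases hxe : x ∈ (e : Sym2 V)
    · refine ⟨x, hxe, ?_⟩
      rintro (⟨-, hx⟩ | ⟨u, -, hu⟩)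
      · exact hx rfl
      · exact G.ne_of_adj u.2 (leafOrEdge_eq_inl hu).1.symm
    · obtain ⟨v, hve, hv⟩ := exists_end_notMem_pushedClass hp (h x) e
      refine ⟨v, hve, ?_⟩
      rintro (⟨hv', -⟩ | ⟨u, -, hu⟩)
      · exact hv hv'
      · obtain ⟨rfl, hl⟩ := leafOrEdge_eq_inl hu
        rw [hl.edge_eq e.2 u.2 hve (Sym2.mem_mk_right x _)] at hxe
        exact hxe (Sym2.mem_mk_left _ _)
  · rintro v e hve (⟨hv, hvx⟩ | ⟨u, -, hu⟩) (⟨he, -⟩ | ⟨u', -, hu'⟩)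
    · exact inr_notMem_pushedClass_of_inl_mem hp hve hv he
    · obtain ⟨he, hl⟩ := leafOrEdge_eq_inr hu'
      rw [he, Sym2.mem_iff] at hve
      rcases hve with rfl | rfl
      · exact hvx rfl
      · rcases inl_mem_pushedClass hv with hv | ⟨hv, -⟩
        · exact hp _ _ u'.2 hv.symm
        · exact hl hv
    · obtain ⟨rfl, hl⟩ := leafOrEdge_eq_inl hu
      refine inr_notMem_pushedClass_of_color hp ?_ he
      rw [hl.edge_eq e.2 u.2 hve (Sym2.mem_mk_right x _)]
      exact Sym2.mem_mk_left _ _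
    · obtain ⟨rfl, hl⟩ := leafOrEdge_eq_inl hu
      obtain ⟨he, hl'⟩ := leafOrEdge_eq_inr hu'
      rw [hl.edge_eq e.2 u.2 hve (Sym2.mem_mk_right x _)] at he
      rw [← Sym2.congr_right.1 he] at hl'
      exact hl' hl

/-- If two neighbours of `x` are leaves or support vertices and `x` has a third neighbour, then
the bound coming from the three colour classes is not attained. -/
theorem three_mul_toidNumber_lt [Finite V] (hnbr : ∀ v, ∃ u, G.Adj v u)
    (hh : IsRainbowColoring G h) {x p q y : V} (hxp : G.Adj x p) (hxq : G.Adj x q)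
    (hxy : G.Adj x y) (hqp : q ≠ p) (hyp : y ≠ p) (hqy : q ≠ y)
    (hq : IsLeafVert G q ∨ IsSupportVert G q) (hy : IsLeafVert G y ∨ IsSupportVert G y) :
    3 * toidNumber (subdivision G) < 2 * Nat.card (V ⊕ G.edgeSet) := by
  let S : Set (G.neighborSet x) := {⟨q, hxq⟩, ⟨y, hxy⟩}
  have hS : S.ncard = 2 := Set.ncard_pair fun hqy' => hqy (congrArg Subtype.val hqy')
  have hlt : toidNumber (subdivision G) + (exchangedClass G h x S).ncard ≤
      Nat.card (V ⊕ G.edgeSet) := by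
    refine toidNumber_add_ncard_le (isTOIDS_exchangedClass_compl hnbr hh hxp ?_ ?_)
    · rintro u (rfl | rfl)
      · exact hqp
      · exact hyp
    · rintro u (rfl | rfl)
      · exact hq
      · exact hy
  have hcard := ncard_exchangedClass hh.1 x S
  have hsum := sum_ncard_pushedClass hh.1
  have hle : ∑ c ∈ Finset.univ.erase (h x),
      (toidNumber (subdivision G) + (pushedClass G h c).ncard) ≤
        2 * Nat.card (V ⊕ G.edgeSet) := by
    refine (Finset.sum_le_card_nsmul _ _ _ fun c _ =>
      toidNumber_add_ncard_le (isTOIDS_pushedClass_compl hnbr hh c)).trans ?_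
    simp [ZMod.card]
  rw [Finset.sum_add_distrib, Finset.sum_const, Finset.card_erase_of_mem (Finset.mem_univ _),
    Finset.card_univ, ZMod.card] at hle
  rw [← Finset.add_sum_erase _ _ (Finset.mem_univ (h x))] at hsum
  simp only [smul_eq_mul] at hle
  omega

end Domination

section Trees

variable {V : Type u} {T : SimpleGraph V}

/-- In a rooted tree a vertex has at most one neighbour closer to the root. -/
theorem parent_unique (hT : T.IsTree) {r v u u' : V} (hu : T.Adj v u) (hu' : T.Adj v u')
    (hd : T.dist r v = T.dist r u + 1) (hd' : T.dist r v = T.dist r u' + 1) : u = u' := by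
  obtain ⟨p, hp⟩ := hT.connected.exists_walk_length_eq_dist r u
  obtain ⟨p', hp'⟩ := hT.connected.exists_walk_length_eq_dist r u'
  have h1 := (p.concat hu.symm).isPath_of_length_eq_dist (by simp [hp, hd])
  have h2 := (p'.concat hu'.symm).isPath_of_length_eq_dist (by simp [hp', hd'])
  have := congrArg Walk.penultimate ((hT.existsUnique_path r v).unique h1 h2)
  simpa using this

theorem exists_ne_adj_of_not_isLeafVert {v u : V} (hu : T.Adj v u) (hl : ¬ IsLeafVert T v) :
    ∃ y, y ≠ u ∧ T.Adj v y := by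
  by_contra! hc
  exact hl ⟨u, hu, fun y hy => by_contra fun hne => hc y hne hy⟩

/-- In a rooted tree a vertex other than the root has a parent. -/
theorem exists_parent (hT : T.IsTree) {r v : V} (hv : v ≠ r) :
    ∃ u, T.Adj v u ∧ T.dist r v = T.dist r u + 1 := by
  obtain ⟨p, hp⟩ := hT.connected.exists_walk_length_eq_dist v r
  cases p with
  | nil => exact (hv rfl).elim
  | @cons _ u _ hvu p =>
    refine ⟨u, hvu, ?_⟩
    have h1 := T.dist_le p
    rw [Walk.length_cons, dist_comm] at hp
    rw [dist_comm] at h1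
    have := hT.dist_eq_dist_add_one_of_adj r hvu
    omega

/-- In a rooted tree a non-leaf other than the root has a child. -/
theorem exists_child (hT : T.IsTree) {r v : V} (hv : v ≠ r) (hl : ¬ IsLeafVert T v) :
    ∃ u, T.Adj v u ∧ T.dist r u = T.dist r v + 1 := by
  obtain ⟨p, hvp, hp⟩ := exists_parent hT hv
  obtain ⟨y, hyp, hvy⟩ := exists_ne_adj_of_not_isLeafVert hvp hl
  refine ⟨y, hvy, ?_⟩
  rcases hT.dist_eq_dist_add_one_of_adj r hvy with hy | hy
  · exact (hyp (parent_unique hT hvy hvp hy hp)).elim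
  · exact hy

theorem isLeafVert_of_dist_eq_diam [Finite V] (hT : T.IsTree) {r v : V} (hv : v ≠ r)
    (hd : T.dist r v = T.diam) : IsLeafVert T v := by
  have := hT.connected.nonempty
  by_contra hl
  obtain ⟨u, -, hu⟩ := exists_child hT hv hl
  have := dist_le_diam (connected_iff_ediam_ne_top.1 hT.connected) (u := r) (v := u)
  omega

/-- Distance modulo three from a leaf. -/
theorem isRainbowColoring_dist (hT : T.IsTree) {r : V} (hr : IsLeafVert T r) :
    IsRainbowColoring T fun v => (T.dist r v : ZMod 3) := by
  have h01 : ∀ a : ZMod 3, a + 1 ≠ a := by decide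
  refine ⟨fun u v huv => ?_, fun v hl c hc => ?_⟩
  · rcases hT.dist_eq_dist_add_one_of_adj r huv with hd | hd
    · simpa only [hd, Nat.cast_add, Nat.cast_one] using h01 _
    · simpa only [hd, Nat.cast_add, Nat.cast_one] using (h01 _).symm
  · have hvr : v ≠ r := fun hvr => hl (hvr ▸ hr)
    obtain ⟨p, hvp, hp⟩ := exists_parent hT hvr
    obtain ⟨u, hvu, hu⟩ := exists_child hT hvr hl
    have key : ∀ a b : ZMod 3, b ≠ a + 1 → a = b ∨ a + 1 + 1 = b := by decide
    simp only [hp, Nat.cast_add, Nat.cast_one] at hc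
    rcases key _ _ hc with h | h
    · exact ⟨p, hvp, h⟩
    · exact ⟨u, hvu, by simpa only [hu, hp, Nat.cast_add, Nat.cast_one] using h⟩

theorem leafCount_le_supportCount [Finite V] (hnbr : ∀ v, ∃ u, T.Adj v u)
    (hsl : ∀ v : V, ¬ IsStrongLeaf T v) : leafCount T ≤ supportCount T := by
  unfold leafCount supportCount
  split_ifs
  · rfl
  choose f hf using hnbr
  refine Set.ncard_le_ncard_of_injOn f (fun v hv => ⟨v, (hf v).symm, hv⟩) ?_
  intro v hv w hw hvw
  by_contra hne
  exact hsl v ⟨hv, f v, hf v, v, w, hne, (hf v).symm, hvw ▸ (hf w).symm, hv, hw⟩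

theorem card_sum_edgeSet_add_one [Finite V] (hT : T.IsTree) :
    Nat.card (V ⊕ T.edgeSet) + 1 = 2 * Nat.card V := by
  classical
  have := Fintype.ofFinite V
  have h := hT.card_edgeFinset
  rw [edgeFinset_card] at h
  simp only [Nat.card_eq_fintype_card, Fintype.card_sum]
  omega

theorem dist_getVert_add_of_isPath (hT : T.IsTree) {a b : V} {w : T.Walk a b} (hw : w.IsPath)
    {k : ℕ} (hk : k ≤ w.length) : T.dist b (w.getVert k) + k = w.length := by
  obtain ⟨p, hp, hl⟩ := hT.connected.exists_path_of_dist a b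
  rw [(hT.existsUnique_path a b).unique hp hw] at hl
  have h1 := T.dist_le (w.take k)
  have h2 := T.dist_le (w.drop k)
  have h3 := hT.connected.dist_triangle (u := a) (v := w.getVert k) (w := b)
  rw [Walk.take_length] at h1
  rw [Walk.drop_length] at h2
  rw [dist_comm]
  omega

end Trees

theorem third_vertex_degree_two {V : Type u} [Fintype V] [DecidableEq V]
    (T : SimpleGraph V) [DecidableRel T.Adj] (hT : T.IsTree)
    (heq : (toidNumber (subdivision T) : ℚ) = (4 * (Nat.card V : ℚ) - leafCount T + supportCount T - 2) / 3)
    (hsl : ∀ v : V, ¬ IsStrongLeaf T v)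
    {a b : V} (w : T.Walk a b) (hw : w.IsPath) (hd : w.length = T.diam)
    (h3 : 3 ≤ T.diam) :
    T.degree (w.getVert 2) = 2 := by
  have hne : ∀ k l, k ≤ 3 → l ≤ 3 → k ≠ l → w.getVert k ≠ w.getVert l := by
    intro k l hk hl hkl heq
    have h1 := dist_getVert_add_of_isPath hT hw (k := k) (by omega)
    have h2 := dist_getVert_add_of_isPath hT hw (k := l) (by omega)
    rw [heq] at h1
    omega
  have hadj : ∀ k, k < 3 → T.Adj (w.getVert k) (w.getVert (k + 1)) := fun k hk =>
    w.adj_getVert_succ (by omega)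
  have hdist : ∀ k, k ≤ 3 → T.dist b (w.getVert k) + k = T.diam := fun k hk =>
    hd ▸ dist_getVert_add_of_isPath hT hw (by omega)
  have hne_root : ∀ v, T.dist b v ≠ 0 → v ≠ b := fun v hv hvb => hv (by rw [hvb, dist_self])
  have hnbr : ∀ v, ∃ u, T.Adj v u := by
    have : Nontrivial V := ⟨_, _, hne 0 1 (by omega) (by omega) (by omega)⟩
    exact fun v => hT.connected.preconnected.exists_adj_of_nontrivial v
  have hba : T.dist b a = T.diam := by simpa using hdist 0 (by omega)
  have hb : IsLeafVert T b := isLeafVert_of_dist_eq_diam hT (r := a)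
    (hne_root a (by omega)).symm (by rw [dist_comm, hba])
  have ha : IsLeafVert T (w.getVert 0) :=
    isLeafVert_of_dist_eq_diam hT (r := b) (hne_root _ (by have := hdist 0; omega))
      (by simpa using hdist 0 (by omega))
  have hq : IsSupportVert T (w.getVert 1) := ⟨_, (hadj 0 (by omega)).symm, ha⟩
  have hxq := (hadj 1 (by omega)).symm
  have hxp := hadj 2 (by omega)
  have hd2 := hdist 2 (by omega)
  have hd3 := hdist 3 (by omega)
  have hqp := hne 1 3 (by omega) (by omega) (by omega)
  by_contra hdeg
  obtain ⟨y, hxy, hyp, hyq⟩ : ∃ y, T.Adj (w.getVert 2) y ∧ y ≠ w.getVert 3 ∧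
      y ≠ w.getVert 1 := by
    by_contra! hc
    refine hdeg ?_
    rw [← card_neighborFinset_eq_degree]
    refine Eq.trans (congrArg Finset.card ?_) (Finset.card_pair hqp)
    ext y
    simp only [mem_neighborFinset, Finset.mem_insert, Finset.mem_singleton]
    constructor
    · intro hy
      by_cases hyp : y = w.getVert 3
      · exact Or.inr hyp
      · exact Or.inl (hc y hy hyp)
    · rintro (rfl | rfl)
      · exact hxq
      · exact hxp
  have hyd : T.dist b y = T.dist b (w.getVert 2) + 1 := by
    rcases hT.dist_eq_dist_add_one_of_adj b hxy with hy | hy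
    · exact (hyp (parent_unique hT hxy hxp hy (by omega))).elim
    · exact hy
  have hy : IsLeafVert T y ∨ IsSupportVert T y := by
    refine or_iff_not_imp_left.2 fun hl => ?_
    obtain ⟨z, hyz, hz⟩ := exists_child hT (hne_root y (by omega)) hl
    exact ⟨z, hyz, isLeafVert_of_dist_eq_diam hT (hne_root z (by omega)) (by omega)⟩
  have hlt := three_mul_toidNumber_lt hnbr (isRainbowColoring_dist hT hb) hxp hxq hxy hqp hyp
    hyq.symm (Or.inr hq) hy
  have hcard := card_sum_edgeSet_add_one hT
  have hls := leafCount_le_supportCount hnbr hsl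
  have h1 : (3 * toidNumber (subdivision T) : ℚ) + 2 + leafCount T =
      4 * Nat.card V + supportCount T := by
    rw [heq]
    ring
  have h2 : 3 * toidNumber (subdivision T) + 2 + leafCount T =
      4 * Nat.card V + supportCount T := by exact_mod_cast h1
  omega
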